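/- arXiv:1810.02003 — 3 statements merged into one kernel-verified Lean document; each statement's English description precedes it below -/
import Mathlib

section
/- Let Ŝ be a groupwise calibrated soft classifier, D̂ a hard post-processor, and Ŷ = D̂∘Ŝ the composed hard classifier, assumed non-trivial on every group g. Then for every group g: PPV_{Ŷ,g} = E[Ŝ(X_g) | Ŷ(X_g) = 1] and NPV_{Ŷ,g} = 1 − E[Ŝ(X_g) | Ŷ(X_g) = 0]. -/
open Finset
open scoped Classical

namespace GroupFairness

noncomputable section

variable {X 𝒢 Ω : Type*} [Fintype X] [Fintype Ω]

/-- The finset of members of group `g`. -/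
def grp (Grp : X → 𝒢) (g : 𝒢) : Finset X :=
  Finset.univ.filter (fun x => Grp x = g)

/-- Expectation of `f x ω` over a uniformly random member `x` of group `g`,
together with internal randomness `ω` distributed according to the weights `w`. -/
def Ex (w : Ω → ℝ) (Grp : X → 𝒢) (g : 𝒢) (f : X → Ω → ℝ) : ℝ :=
  (∑ x ∈ grp Grp g, ∑ ω : Ω, w ω * f x ω) / ((grp Grp g).card : ℝ)

/-- Probability of the event `E x ω` for a uniformly random member of group `g`. -/
def Pr (w : Ω → ℝ) (Grp : X → 𝒢) (g : 𝒢) (E : X → Ω → Prop) : ℝ :=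
  Ex w Grp g (fun x ω => if E x ω then 1 else 0)

/-- Conditional probability of `E` given `F`. -/
def cPr (w : Ω → ℝ) (Grp : X → 𝒢) (g : 𝒢) (E F : X → Ω → Prop) : ℝ :=
  Pr w Grp g (fun x ω => E x ω ∧ F x ω) / Pr w Grp g F

/-- `w` is a probability weighting on the randomness space. -/
def ValidWeights (w : Ω → ℝ) : Prop :=
  (∀ ω, 0 ≤ w ω) ∧ ∑ ω : Ω, w ω = 1

/-- The base rate of group `g`: the probability that a uniformly random member
of `g` has true type `1`. -/
def BaseRate (w : Ω → ℝ) (Grp : X → 𝒢) (Y : X → Bool) (g : 𝒢) : ℝ :=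
  Pr w Grp g (fun x _ => Y x = true)

/-- All scores of the soft classifier lie in `[0,1]`. -/
def IsSoft (S : X → Ω → ℝ) : Prop :=
  ∀ x ω, 0 ≤ S x ω ∧ S x ω ≤ 1

/-- `S` is groupwise calibrated: for every group `g` and score `s` occurring with
positive probability, `Pr[Y = 1 ∣ S = s] = s`. -/
def Calibrated (w : Ω → ℝ) (Grp : X → 𝒢) (Y : X → Bool) (S : X → Ω → ℝ) : Prop :=
  ∀ (g : 𝒢) (s : ℝ), 0 < Pr w Grp g (fun x ω => S x ω = s) →
    cPr w Grp g (fun x _ => Y x = true) (fun x ω => S x ω = s) = s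

/-- The accuracy profile of `S` on group `g`: the pmf of the score `S(X_g)`. -/
def AP (w : Ω → ℝ) (Grp : X → 𝒢) (S : X → Ω → ℝ) (g : 𝒢) (s : ℝ) : ℝ :=
  Pr w Grp g (fun x ω => S x ω = s)

/-- The support of the accuracy profile of `S` on group `g`. -/
def APsupp (w : Ω → ℝ) (Grp : X → 𝒢) (S : X → Ω → ℝ) (g : 𝒢) : Set ℝ :=
  {s | 0 < AP w Grp S g s}

/-- The accuracy profile is *nice*: all groups have the same support. -/
def NiceAP (w : Ω → ℝ) (Grp : X → 𝒢) (S : X → Ω → ℝ) : Prop :=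
  ∀ g g' : 𝒢, APsupp w Grp S g = APsupp w Grp S g'

/-- A (randomized) hard post-processor is described by the probability `q s g` of
outputting `1` on score `s` and group `g`; it is valid if these are probabilities. -/
def ValidPP (q : ℝ → 𝒢 → ℝ) : Prop :=
  ∀ (s : ℝ) (g : 𝒢), 0 ≤ q s g ∧ q s g ≤ 1

/-- Probability that the composed hard classifier `D̂ ∘ Ŝ` outputs `1` on group `g`. -/
def prPos (w : Ω → ℝ) (Grp : X → 𝒢) (S : X → Ω → ℝ) (q : ℝ → 𝒢 → ℝ) (g : 𝒢) : ℝ :=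
  Ex w Grp g (fun x ω => q (S x ω) (Grp x))

/-- Probability that the composed hard classifier `D̂ ∘ Ŝ` outputs `0` on group `g`. -/
def prNeg (w : Ω → ℝ) (Grp : X → 𝒢) (S : X → Ω → ℝ) (q : ℝ → 𝒢 → ℝ) (g : 𝒢) : ℝ :=
  Ex w Grp g (fun x ω => 1 - q (S x ω) (Grp x))

/-- The composed hard classifier is non-trivial on `g`. -/
def NonTrivial (w : Ω → ℝ) (Grp : X → 𝒢) (S : X → Ω → ℝ) (q : ℝ → 𝒢 → ℝ) (g : 𝒢) : Prop :=
  0 < prPos w Grp S q g ∧ 0 < prNeg w Grp S q g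

/-- Positive predictive value `Pr[Y = 1 ∣ Ŷ = 1]` of the composed classifier on `g`. -/
def PPV (w : Ω → ℝ) (Grp : X → 𝒢) (Y : X → Bool) (S : X → Ω → ℝ)
    (q : ℝ → 𝒢 → ℝ) (g : 𝒢) : ℝ :=
  Ex w Grp g (fun x ω => (if Y x then 1 else 0) * q (S x ω) (Grp x)) / prPos w Grp S q g

/-- Negative predictive value `Pr[Y = 0 ∣ Ŷ = 0]` of the composed classifier on `g`. -/
def NPV (w : Ω → ℝ) (Grp : X → 𝒢) (Y : X → Bool) (S : X → Ω → ℝ)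
    (q : ℝ → 𝒢 → ℝ) (g : 𝒢) : ℝ :=
  Ex w Grp g (fun x ω => (if Y x then 0 else 1) * (1 - q (S x ω) (Grp x))) / prNeg w Grp S q g

/-- False positive rate `Pr[Ŷ = 1 ∣ Y = 0]` of the composed classifier on `g`. -/
def FPR (w : Ω → ℝ) (Grp : X → 𝒢) (Y : X → Bool) (S : X → Ω → ℝ)
    (q : ℝ → 𝒢 → ℝ) (g : 𝒢) : ℝ :=
  Ex w Grp g (fun x ω => (if Y x then 0 else 1) * q (S x ω) (Grp x)) /
    Pr w Grp g (fun x _ => Y x = false)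

/-- False negative rate `Pr[Ŷ = 0 ∣ Y = 1]` of the composed classifier on `g`. -/
def FNR (w : Ω → ℝ) (Grp : X → 𝒢) (Y : X → Bool) (S : X → Ω → ℝ)
    (q : ℝ → 𝒢 → ℝ) (g : 𝒢) : ℝ :=
  Ex w Grp g (fun x ω => (if Y x then 1 else 0) * (1 - q (S x ω) (Grp x))) /
    Pr w Grp g (fun x _ => Y x = true)

/-- The threshold post-processor with threshold `τ g` and on-threshold probability
`R g` for group `g`: it outputs `1` with probability `1` above the threshold, `0`
below it, and `1` with probability `R g` at the threshold. -/
def thresholdPP (τ R : 𝒢 → ℝ) : ℝ → 𝒢 → ℝ := fun s g =>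
  if τ g < s then 1 else if s = τ g then R g else 0

lemma Ex_sub (w : Ω → ℝ) (Grp : X → 𝒢) (g : 𝒢) (f h : X → Ω → ℝ) :
    Ex w Grp g (fun x ω => f x ω - h x ω) = Ex w Grp g f - Ex w Grp g h := by
  simp only [Ex, mul_sub, Finset.sum_sub_distrib, sub_div]

lemma Ex_const_mul (w : Ω → ℝ) (Grp : X → 𝒢) (g : 𝒢) (c : ℝ) (f : X → Ω → ℝ) :
    Ex w Grp g (fun x ω => c * f x ω) = c * Ex w Grp g f := by
  simp only [Ex, mul_left_comm _ c, ← Finset.mul_sum, mul_div_assoc]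

lemma Ex_sum {ι : Type*} (w : Ω → ℝ) (Grp : X → 𝒢) (g : 𝒢) (T : Finset ι)
    (f : ι → X → Ω → ℝ) :
    Ex w Grp g (fun x ω => ∑ i ∈ T, f i x ω) = ∑ i ∈ T, Ex w Grp g (f i) := by
  simp only [Ex, Finset.mul_sum, ← Finset.sum_div]
  congr 1
  conv_rhs => rw [Finset.sum_comm]
  exact Finset.sum_congr rfl fun x _ => Finset.sum_comm

lemma Ex_mono {w : Ω → ℝ} (hw : ∀ ω, 0 ≤ w ω) (Grp : X → 𝒢) (g : 𝒢)
    {f h : X → Ω → ℝ} (hfh : ∀ x ω, f x ω ≤ h x ω) :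
    Ex w Grp g f ≤ Ex w Grp g h := by
  unfold Ex
  gcongr with x _ ω _
  · exact hw ω
  · exact hfh x ω

lemma Pr_nonneg {w : Ω → ℝ} (hw : ∀ ω, 0 ≤ w ω) (Grp : X → 𝒢) (g : 𝒢)
    (E : X → Ω → Prop) : 0 ≤ Pr w Grp g E := by
  refine le_of_eq_of_le ?_ (Ex_mono hw Grp g (f := fun _ _ => 0) fun x ω => ?_)
  · simp [Ex]
  · split_ifs <;> norm_num

lemma Pr_mono {w : Ω → ℝ} (hw : ∀ ω, 0 ≤ w ω) (Grp : X → 𝒢) (g : 𝒢)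
    {E F : X → Ω → Prop} (hEF : ∀ x ω, E x ω → F x ω) :
    Pr w Grp g E ≤ Pr w Grp g F := by
  refine Ex_mono hw Grp g fun x ω => ?_
  by_cases hE : E x ω
  · simp [hE, hEF x ω hE]
  · simp only [hE, if_false]
    split_ifs <;> norm_num

/-- The expectation of a function of the score decomposes over the finitely many scores. -/
lemma Ex_mul_comp_score (w : Ω → ℝ) (Grp : X → 𝒢) (g : 𝒢) (S : X → Ω → ℝ)
    (f : X → Ω → ℝ) (h : ℝ → ℝ) :
    Ex w Grp g (fun x ω => f x ω * h (S x ω)) =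
      ∑ s ∈ Finset.univ.image (fun p : X × Ω => S p.1 p.2),
        h s * Ex w Grp g (fun x ω => f x ω * if S x ω = s then 1 else 0) := by
  simp only [← Ex_const_mul, ← Ex_sum]
  congr 1
  funext x ω
  rw [Finset.sum_eq_single_of_mem (S x ω)
    (Finset.mem_image_of_mem (fun p : X × Ω => S p.1 p.2) (Finset.mem_univ (x, ω)))]
  · simp [mul_comm]
  · intro s _ hs
    simp [hs.symm]

/-- The product form of calibration, valid also at scores of probability zero. -/
lemma Calibrated.Pr_and_eq {w : Ω → ℝ} (hw : ∀ ω, 0 ≤ w ω) {Grp : X → 𝒢} {Y : X → Bool}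
    {S : X → Ω → ℝ} (hcal : Calibrated w Grp Y S) (g : 𝒢) (s : ℝ) :
    Pr w Grp g (fun x ω => Y x = true ∧ S x ω = s) =
      s * Pr w Grp g (fun x ω => S x ω = s) := by
  rcases (Pr_nonneg hw Grp g fun x ω => S x ω = s).eq_or_lt' with h0 | hpos
  · have hle := Pr_mono hw Grp g (E := fun x ω => Y x = true ∧ S x ω = s)
      (F := fun x ω => S x ω = s) fun _ _ hE => hE.2
    rw [h0] at hle ⊢
    rw [mul_zero]
    exact le_antisymm hle (Pr_nonneg hw Grp g _)
  · exact (div_eq_iff hpos.ne').mp (hcal g s hpos)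

/-- Under calibration the true type may be replaced by the score in expectations weighted
by a function of the score. -/
lemma Calibrated.Ex_mul_comp_score {w : Ω → ℝ} (hw : ∀ ω, 0 ≤ w ω) {Grp : X → 𝒢}
    {Y : X → Bool} {S : X → Ω → ℝ} (hcal : Calibrated w Grp Y S) (g : 𝒢) (h : ℝ → ℝ) :
    Ex w Grp g (fun x ω => (if Y x then 1 else 0) * h (S x ω)) =
      Ex w Grp g (fun x ω => S x ω * h (S x ω)) := by
  rw [GroupFairness.Ex_mul_comp_score, GroupFairness.Ex_mul_comp_score]
  refine Finset.sum_congr rfl fun s _ => ?_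
  congr 1
  have hY := hcal.Pr_and_eq hw g s
  simp only [Pr, ← Ex_const_mul] at hY
  convert hY using 4 with x ω x ω
  · by_cases h1 : Y x = true <;> by_cases h2 : S x ω = s <;> simp [h1, h2]
  · by_cases h2 : S x ω = s <;> simp [h2]

/-- Averages over group `g` only see the values of the integrand on `g`. -/
lemma Ex_congr (w : Ω → ℝ) (Grp : X → 𝒢) (g : 𝒢) {f h : X → Ω → ℝ}
    (hfh : ∀ x ω, Grp x = g → f x ω = h x ω) : Ex w Grp g f = Ex w Grp g h := by
  unfold Ex
  congr 1
  refine Finset.sum_congr rfl fun x hx => Finset.sum_congr rfl fun ω _ => ?_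
  rw [hfh x ω (Finset.mem_filter.mp hx).2]

lemma Calibrated.Ex_mul_comp_score_group {w : Ω → ℝ} (hw : ∀ ω, 0 ≤ w ω) {Grp : X → 𝒢}
    {Y : X → Bool} {S : X → Ω → ℝ} (hcal : Calibrated w Grp Y S) (g : 𝒢) (h : ℝ → 𝒢 → ℝ) :
    Ex w Grp g (fun x ω => (if Y x then 1 else 0) * h (S x ω) (Grp x)) =
      Ex w Grp g (fun x ω => S x ω * h (S x ω) (Grp x)) := by
  rw [Ex_congr w Grp g fun x ω hx => by rw [hx], hcal.Ex_mul_comp_score hw g fun s => h s g]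
  exact Ex_congr w Grp g fun x ω hx => by rw [hx]

/-- For a groupwise calibrated soft classifier post-processed by a
hard post-processor into a classifier non-trivial on every group,
`PPV_g = E[Ŝ(X_g) ∣ Ŷ(X_g) = 1]` and `NPV_g = 1 − E[Ŝ(X_g) ∣ Ŷ(X_g) = 0]`. -/
theorem PPV_NPV_as_conditional_expectations
    (w : Ω → ℝ) (Grp : X → 𝒢) (Y : X → Bool) (S : X → Ω → ℝ) (q : ℝ → 𝒢 → ℝ)
    (hw : ValidWeights w) (hne : ∀ g : 𝒢, (grp Grp g).Nonempty)
    (hS : IsSoft S) (hcal : Calibrated w Grp Y S) (hq : ValidPP q)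
    (hnt : ∀ g : 𝒢, NonTrivial w Grp S q g) (g : 𝒢) :
    PPV w Grp Y S q g =
        Ex w Grp g (fun x ω => S x ω * q (S x ω) (Grp x)) / prPos w Grp S q g ∧
      NPV w Grp Y S q g =
        1 - Ex w Grp g (fun x ω => S x ω * (1 - q (S x ω) (Grp x))) / prNeg w Grp S q g := by
  refine ⟨?_, ?_⟩
  · rw [PPV, hcal.Ex_mul_comp_score_group hw.1 g q]
  · rw [NPV, eq_sub_iff_add_eq, ← add_div, div_eq_one_iff_eq (hnt g).2.ne',
      ← hcal.Ex_mul_comp_score_group hw.1 g fun s g => 1 - q s g, ← eq_sub_iff_add_eq,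
      prNeg, ← Ex_sub]
    congr 1
    funext x ω
    by_cases hY : Y x = true <;> simp [hY]

end

end GroupFairness
end

section
/- Fix two disjoint groups g₁ and g₂ with base rates BR₁ ≠ BR₂. Then there exists a groupwise calibrated soft classifier Ŝ such that for every hard post-processor D̂ : [0,1] × 𝒢 → {0,1} with Pr[D̂(BR₁, g₁) = 1] > 0 and Pr[D̂(BR₂, g₂) = 1] > 0, the composed hard classifier Ŷ = D̂∘Ŝ does not equalize PPV across the two groups, i.e., PPV_{Ŷ,g₁} ≠ PPV_{Ŷ,g₂}. -/
open Finset
open scoped Classical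

namespace GroupFairness

noncomputable section

variable {X 𝒢 Ω : Type*} [Fintype X] [Fintype Ω]

theorem Ex_const_on_grp {w : Ω → ℝ} {Grp : X → 𝒢} (hw : ValidWeights w) {g : 𝒢}
    {f : X → Ω → ℝ} (a : X → ℝ) (h : ∀ x, Grp x = g → ∀ ω, f x ω = a x) :
    Ex w Grp g f = (∑ x ∈ grp Grp g, a x) / ((grp Grp g).card : ℝ) := by
  unfold Ex
  congr 1
  refine Finset.sum_congr rfl fun x hx => ?_
  have hx' : Grp x = g := by simpa [grp] using hx
  simp only [h x hx']
  rw [← Finset.sum_mul, hw.2, one_mul]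

theorem Ex_const {w : Ω → ℝ} {Grp : X → 𝒢} (hw : ValidWeights w) {g : 𝒢}
    (hne : (grp Grp g).Nonempty) {f : X → Ω → ℝ} {c : ℝ}
    (h : ∀ x, Grp x = g → ∀ ω, f x ω = c) : Ex w Grp g f = c := by
  have hc : ((grp Grp g).card : ℝ) ≠ 0 := by exact_mod_cast hne.card_pos.ne'
  rw [Ex_const_on_grp hw (fun _ => c) h, Finset.sum_const, nsmul_eq_mul]
  field_simp

theorem BaseRate_eq {w : Ω → ℝ} (Grp : X → 𝒢) (Y : X → Bool) (hw : ValidWeights w) (g : 𝒢) :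
    BaseRate w Grp Y g =
      (∑ x ∈ grp Grp g, if Y x = true then (1 : ℝ) else 0) / ((grp Grp g).card : ℝ) :=
  Ex_const_on_grp hw _ fun _ _ _ => by congr

theorem BaseRate_mem_unitInterval {w : Ω → ℝ} (Grp : X → 𝒢) (Y : X → Bool)
    (hw : ValidWeights w) (g : 𝒢) : 0 ≤ BaseRate w Grp Y g ∧ BaseRate w Grp Y g ≤ 1 := by
  rw [BaseRate_eq Grp Y hw]
  refine ⟨div_nonneg (Finset.sum_nonneg fun x _ => by split_ifs <;> norm_num) (by positivity),
    div_le_one_of_le₀ ?_ (by positivity)⟩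
  calc _ ≤ ∑ x ∈ grp Grp g, (1 : ℝ) :=
        Finset.sum_le_sum fun x _ => by split_ifs <;> norm_num
    _ = _ := by simp

/-- Scoring every instance by the base rate of its group is groupwise calibrated. -/
theorem calibrated_baseRate {w : Ω → ℝ} {Grp : X → 𝒢} (Y : X → Bool) (hw : ValidWeights w)
    (hne : ∀ g : 𝒢, (grp Grp g).Nonempty) :
    Calibrated w Grp Y (fun x _ => BaseRate w Grp Y (Grp x)) := by
  intro g s hs
  by_cases h : BaseRate w Grp Y g = s
  · have h1 : Pr w Grp g (fun x (_ : Ω) => BaseRate w Grp Y (Grp x) = s) = 1 :=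
      Ex_const hw (hne g) fun x hx ω => by simp [hx, h]
    have h2 : Pr w Grp g (fun x (_ : Ω) => Y x = true ∧ BaseRate w Grp Y (Grp x) = s) = s := by
      rw [← h, BaseRate_eq Grp Y hw g]
      exact Ex_const_on_grp hw _ fun x hx ω => by simp [hx, BaseRate_eq Grp Y hw g]
    rw [cPr, h1, h2, div_one]
  · have h0 : Pr w Grp g (fun x (_ : Ω) => BaseRate w Grp Y (Grp x) = s) = 0 :=
      Ex_const hw (hne g) fun x hx ω => by simp [hx, h]
    exact absurd hs (by rw [h0]; exact lt_irrefl 0)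

/-- Under base-rate scoring, every post-processor that outputs `1` on `g` with positive
probability has PPV equal to the base rate of `g`. -/
theorem PPV_baseRate {w : Ω → ℝ} {Grp : X → 𝒢} (Y : X → Bool) (hw : ValidWeights w)
    {g : 𝒢} (hne : (grp Grp g).Nonempty) {q : ℝ → 𝒢 → ℝ}
    (hq : 0 < q (BaseRate w Grp Y g) g) :
    PPV w Grp Y (fun x _ => BaseRate w Grp Y (Grp x)) q g = BaseRate w Grp Y g := by
  have h1 : prPos w Grp (fun x (_ : Ω) => BaseRate w Grp Y (Grp x)) q g =
      q (BaseRate w Grp Y g) g :=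
    Ex_const hw hne fun x hx ω => by simp only [hx]
  rw [PPV, h1, Ex_const_on_grp hw
    (fun x => (if Y x = true then 1 else 0) * q (BaseRate w Grp Y g) g)
    fun x hx ω => by simp only [hx], ← Finset.sum_mul, mul_div_right_comm,
    mul_div_cancel_right₀ _ hq.ne', BaseRate_eq Grp Y hw]

/-- For two groups with different base rates there is a groupwise
calibrated soft classifier such that no hard post-processor that outputs `1` with
positive probability on input `(BRᵢ, gᵢ)` for `i = 1, 2` yields a composed classifier
equalizing PPV across the two groups. -/
theorem exists_calibrated_no_postprocessor_equalizes_PPV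
    (w : Ω → ℝ) (Grp : X → 𝒢) (Y : X → Bool)
    (hw : ValidWeights w) (hne : ∀ g : 𝒢, (grp Grp g).Nonempty)
    (g₁ g₂ : 𝒢) (hgg : g₁ ≠ g₂)
    (hBR : BaseRate w Grp Y g₁ ≠ BaseRate w Grp Y g₂) :
    ∃ S : X → Ω → ℝ, IsSoft S ∧ Calibrated w Grp Y S ∧
      ∀ q : ℝ → 𝒢 → ℝ, ValidPP q →
        0 < q (BaseRate w Grp Y g₁) g₁ →
        0 < q (BaseRate w Grp Y g₂) g₂ →
        PPV w Grp Y S q g₁ ≠ PPV w Grp Y S q g₂ := by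
  refine ⟨fun x _ => BaseRate w Grp Y (Grp x),
    fun x _ => BaseRate_mem_unitInterval Grp Y hw (Grp x),
    calibrated_baseRate Y hw hne, fun q _ h₁ h₂ => ?_⟩
  rwa [PPV_baseRate Y hw (hne g₁) h₁, PPV_baseRate Y hw (hne g₂) h₂]

end

end GroupFairness
end

section
/- Let Ŝ be a groupwise calibrated soft classifier whose accuracy profile is nice (all groups' score supports are equal). Let D̂_{(τ,R)} be a group-blind threshold post-processor with τ(g) = max(Supp(𝒫_g)) for every group g. Then the composed hard classifier Ŷ = D̂_{(τ,R)}∘Ŝ equalizes PPV across all groups g on which Ŷ is non-trivial: for any two such groups g, g', PPV_{Ŷ,g} = PPV_{Ŷ,g'}. -/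
open Finset
open scoped Classical

namespace GroupFairness

noncomputable section

variable {X 𝒢 Ω : Type*} [Fintype X] [Fintype Ω]

/-- A score attained by a member of `g` under an outcome of positive weight lies in
the support of the accuracy profile of `g`. -/
theorem mem_APsupp_of_pos {w : Ω → ℝ} (hw : ∀ ω, 0 ≤ w ω) {Grp : X → 𝒢} (S : X → Ω → ℝ)
    {g : 𝒢} {x : X} (hx : x ∈ grp Grp g) {ω : Ω} (hω : 0 < w ω) :
    S x ω ∈ APsupp w Grp S g := by
  simp only [APsupp, Set.mem_ofPred_eq, AP, Pr, Ex, mul_ite, mul_one, mul_zero]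
  refine div_pos ?_ (Nat.cast_pos.mpr (Finset.card_pos.mpr ⟨x, hx⟩))
  refine Finset.sum_pos' (fun y _ => Finset.sum_nonneg fun ω' _ => ?_) ⟨x, hx, ?_⟩
  · exact ite_nonneg (hw ω') le_rfl
  · exact Finset.sum_pos' (fun ω' _ => ite_nonneg (hw ω') le_rfl)
      ⟨ω, Finset.mem_univ ω, by simpa using hω⟩

/-- If no score in the support exceeds `t`, the post-processor with threshold `t` outputs `1`
only at the score `t`, with probability `r`, up to outcomes of weight zero. -/
theorem Ex_mul_thresholdPP {w : Ω → ℝ} (hw : ∀ ω, 0 ≤ w ω) (Grp : X → 𝒢) (S : X → Ω → ℝ)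
    {t : ℝ} (r : ℝ) {g : 𝒢} (hmax : ∀ s ∈ APsupp w Grp S g, s ≤ t) (f : X → ℝ) :
    Ex w Grp g (fun x ω => f x * thresholdPP (fun _ => t) (fun _ => r) (S x ω) (Grp x)) =
      r * Ex w Grp g (fun x ω => f x * if S x ω = t then 1 else 0) := by
  simp only [Ex, ← mul_div_assoc, Finset.mul_sum]
  congr 1
  refine Finset.sum_congr rfl fun x hx => Finset.sum_congr rfl fun ω _ => ?_
  rcases (hw ω).eq_or_lt with h | h
  · simp [← h]
  · have hle := hmax _ (mem_APsupp_of_pos hw S hx h)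
    simp only [thresholdPP, if_neg hle.not_gt]
    split_ifs <;> ring

/-- With its threshold at the maximum `t` of the support, a threshold post-processor of a
calibrated classifier has PPV equal to `t` wherever it outputs `1` with positive probability. -/
theorem PPV_thresholdPP_eq {w : Ω → ℝ} (hw : ∀ ω, 0 ≤ w ω) {Grp : X → 𝒢} {Y : X → Bool}
    {S : X → Ω → ℝ} {t r : ℝ} (hcal : Calibrated w Grp Y S) {g : 𝒢}
    (ht : t ∈ APsupp w Grp S g) (hmax : ∀ s ∈ APsupp w Grp S g, s ≤ t)
    (hpos : 0 < prPos w Grp S (thresholdPP (fun _ => t) (fun _ => r)) g) :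
    PPV w Grp Y S (thresholdPP (fun _ => t) (fun _ => r)) g = t := by
  have hden : prPos w Grp S (thresholdPP (fun _ => t) (fun _ => r)) g =
      r * Pr w Grp g (fun x ω => S x ω = t) := by
    rw [prPos, Pr]
    convert Ex_mul_thresholdPP hw Grp S r hmax (fun _ => 1) using 4 <;> simp only [one_mul]
  have hr : r ≠ 0 := by
    rintro rfl
    simp [hden] at hpos
  have hnum : Ex w Grp g (fun x ω => (if Y x then 1 else 0) * if S x ω = t then 1 else 0) =
      Pr w Grp g (fun x ω => Y x = true ∧ S x ω = t) := by
    unfold Pr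
    congr! 3 with x ω
    split_ifs <;> simp_all
  rw [PPV, hden, Ex_mul_thresholdPP hw Grp S r hmax (fun x => if Y x then 1 else 0), hnum,
    mul_div_mul_left _ _ hr]
  exact hcal g t ht

/-- For a nice, groupwise calibrated soft classifier, the group-blind
threshold post-processor whose threshold is the maximum of the (common) support
equalizes PPV across all groups on which the composed classifier is non-trivial. -/
theorem groupBlind_maxThreshold_equalizes_PPV
    (w : Ω → ℝ) (Grp : X → 𝒢) (Y : X → Bool) (S : X → Ω → ℝ) (t r : ℝ)
    (hw : ValidWeights w) (hne : ∀ g : 𝒢, (grp Grp g).Nonempty)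
    (hS : IsSoft S) (hcal : Calibrated w Grp Y S) (hnice : NiceAP w Grp S)
    (hr0 : 0 ≤ r) (hr1 : r ≤ 1)
    (hmax : ∀ g : 𝒢, t ∈ APsupp w Grp S g ∧ ∀ s ∈ APsupp w Grp S g, s ≤ t)
    (g g' : 𝒢)
    (hg : NonTrivial w Grp S (thresholdPP (fun _ => t) (fun _ => r)) g)
    (hg' : NonTrivial w Grp S (thresholdPP (fun _ => t) (fun _ => r)) g') :
    PPV w Grp Y S (thresholdPP (fun _ => t) (fun _ => r)) g =
      PPV w Grp Y S (thresholdPP (fun _ => t) (fun _ => r)) g' := by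
  rw [PPV_thresholdPP_eq hw.1 hcal (hmax g).1 (hmax g).2 hg.1,
    PPV_thresholdPP_eq hw.1 hcal (hmax g').1 (hmax g').2 hg'.1]

end

end GroupFairness
end
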